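/- arXiv:1904.00576 — 4 statements merged into one kernel-verified Lean document; each statement's English description precedes it below -/
import Mathlib

section
/- Let 1 < p < ∞ and p′ = p/(p−1). There exists a constant C_{n,p} > 0 depending only on n and p such that for every z ∈ 𝒰 the function K_z := K(·, z) belongs to Aᵖ(𝒰) and ‖K_z‖ₚ = C_{n,p} · ρ(z)^{−(n+1)/p′}. -/
open MeasureTheory Filter

noncomputable section

/-- Points of ℂⁿ written `z = (z′, zₙ)` with `z′ ∈ ℂ^m`, `m = n - 1`. -/
abbrev SPoint (m : ℕ) := (Fin m → ℂ) × ℂ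

/-- `ρ(z,w) = (i/2)(w̄ₙ − zₙ) − z′·w̄′`. -/
def srho2 {m : ℕ} (z w : SPoint m) : ℂ :=
  Complex.I / 2 * ((starRingEnd ℂ) w.2 - z.2) - ∑ j, z.1 j * (starRingEnd ℂ) (w.1 j)

/-- `ρ(z) = Im zₙ − |z′|²`. -/
def srho {m : ℕ} (z : SPoint m) : ℝ :=
  z.2.im - ∑ j, ‖z.1 j‖ ^ 2

/-- The Siegel upper half-space `𝒰 = {z : ρ(z) > 0}`. -/
def Siegel (m : ℕ) : Set (SPoint m) := {z | 0 < srho z}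

/-- The Bergman kernel `K(z,w) = (n!/(4πⁿ)) ρ(z,w)^{−(n+1)}` (points in ℂⁿ = ℂ^{n-1} × ℂ). -/
def sK (n : ℕ) (z w : SPoint (n - 1)) : ℂ :=
  (n.factorial : ℂ) / (4 * (Real.pi : ℂ) ^ n) * srho2 z w ^ (-(n + 1 : ℤ))

/-- Inverse hyperbolic tangent. -/
def artanh (x : ℝ) : ℝ := (1 / 2) * Real.log ((1 + x) / (1 - x))

/-- The Bergman distance `β(z,w) = artanh √(1 − ρ(z)ρ(w)/|ρ(z,w)|²)`. -/
def sbeta {m : ℕ} (z w : SPoint m) : ℝ :=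
  artanh (Real.sqrt (1 - srho z * srho w / ‖srho2 z w‖ ^ 2))

/-- The Bergman metric ball `D(z,r)`. -/
def sball {m : ℕ} (z : SPoint m) (r : ℝ) : Set (SPoint m) :=
  {w ∈ Siegel m | sbeta z w < r}

/-- Membership in the Bergman space `Aᵖ(𝒰)`: holomorphic with `∫_𝒰 |f|ᵖ dV < ∞`. -/
def MemAp (n : ℕ) (p : ℝ) (f : SPoint (n - 1) → ℂ) : Prop :=
  DifferentiableOn ℂ f (Siegel (n - 1)) ∧
    IntegrableOn (fun z => ‖f z‖ ^ p) (Siegel (n - 1)) volume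

/-- `‖f‖ₚ = (∫_𝒰 |f|ᵖ dV)^{1/p}`. -/
def bNorm (n : ℕ) (p : ℝ) (f : SPoint (n - 1) → ℂ) : ℝ :=
  (∫ z in Siegel (n - 1), ‖f z‖ ^ p) ^ (1 / p)

/-- The space `𝒮_α` of holomorphic `f` on `𝒰` with `sup_z |zₙ + i|^α |f(z)| < ∞`. -/
def SAlpha (n : ℕ) (α : ℝ) (f : SPoint (n - 1) → ℂ) : Prop :=
  DifferentiableOn ℂ f (Siegel (n - 1)) ∧
    ∃ M : ℝ, ∀ z ∈ Siegel (n - 1), ‖z.2 + Complex.I‖ ^ α * ‖f z‖ ≤ M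

end

/-- A function on a real vector space that is homogeneous of degree `a` up to a change of
parameter has its integral scaled by `R ^ (dim + a)`. -/
lemma lintegral_eq_of_comp_smul {E : Type*} [NormedAddCommGroup E] [NormedSpace ℝ E]
    [FiniteDimensional ℝ E] [MeasurableSpace E] [BorelSpace E] (μ : Measure E)
    [μ.IsAddHaarMeasure] {R a : ℝ} (hR : 0 < R) {f g : E → ENNReal}
    (hfg : ∀ x, f (R • x) = ENNReal.ofReal (R ^ a) * g x) :
    ∫⁻ x, f x ∂μ =
      ENNReal.ofReal (R ^ ((Module.finrank ℝ E : ℝ) + a)) * ∫⁻ x, g x ∂μ := by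
  have hmap : ∫⁻ x, f (R • x) ∂μ =
      ENNReal.ofReal (abs (R ^ Module.finrank ℝ E)⁻¹) * ∫⁻ x, f x ∂μ := by
    rw [← smul_eq_mul, ← lintegral_smul_measure, ← Measure.map_addHaar_smul μ hR.ne']
    exact ((Homeomorph.smulOfNeZero R hR.ne').measurableEmbedding.lintegral_map f).symm
  simp_rw [hfg] at hmap
  rw [lintegral_const_mul' _ _ ENNReal.ofReal_ne_top] at hmap
  have hd : 0 < R ^ Module.finrank ℝ E := pow_pos hR _
  rw [Real.rpow_add hR, Real.rpow_natCast, ENNReal.ofReal_mul hd.le, mul_assoc, hmap,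
    ← mul_assoc, abs_of_pos (inv_pos.2 hd), ← ENNReal.ofReal_mul hd.le,
    mul_inv_cancel₀ hd.ne', ENNReal.ofReal_one, one_mul]

/-- The model integral `∫_{Im ζ > 0} |ζ + i|^{-s}`. -/
noncomputable def halfPlaneIntegral (s : ℝ) : ENNReal :=
  ∫⁻ ζ in {ζ : ℂ | 0 < ζ.im}, ENNReal.ofReal (‖ζ + Complex.I‖ ^ (-s))

/-- The model integral `∫_{ℂ^m} (1 + |x|²)^{-r}`. -/
noncomputable def bracketIntegral (m : ℕ) (r : ℝ) : ENNReal :=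
  ∫⁻ x : Fin m → ℂ, ENNReal.ofReal ((1 + ∑ j, ‖x j‖ ^ 2) ^ (-r))

lemma measurableSet_upperHalfPlane : MeasurableSet {ζ : ℂ | 0 < ζ.im} :=
  measurableSet_lt measurable_const Complex.measurable_im

lemma lintegral_halfPlane_rpow (s : ℝ) {t : ℝ} (ht : 0 < t) :
    ∫⁻ ζ in {ζ : ℂ | 0 < ζ.im}, ENNReal.ofReal (‖ζ + t * Complex.I‖ ^ (-s)) =
      ENNReal.ofReal (t ^ (2 - s)) * halfPlaneIntegral s := by
  rw [halfPlaneIntegral, ← lintegral_indicator measurableSet_upperHalfPlane,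
    ← lintegral_indicator measurableSet_upperHalfPlane,
    lintegral_eq_of_comp_smul (g := Set.indicator {ζ : ℂ | 0 < ζ.im}
      fun ζ => ENNReal.ofReal (‖ζ + Complex.I‖ ^ (-s))) volume ht (a := -s)]
  · rw [Complex.finrank_real_complex, sub_eq_add_neg, Nat.cast_ofNat]
  · intro ζ
    by_cases hζ : 0 < ζ.im
    · have h : (0 : ℝ) < (t • ζ).im := by
        simpa using mul_pos ht hζ
      rw [Set.indicator_of_mem (by exact h), Set.indicator_of_mem (by exact hζ),
        ← ENNReal.ofReal_mul (by positivity), ← Real.mul_rpow ht.le (norm_nonneg _)]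
      congr 2
      rw [Complex.real_smul, ← mul_add, norm_mul, Complex.norm_real, Real.norm_of_nonneg ht.le]
    · have h : ¬ (0 : ℝ) < (t • ζ).im := by
        simpa [mul_pos_iff_of_pos_left ht] using hζ
      rw [Set.indicator_of_notMem (by exact h), Set.indicator_of_notMem (by exact hζ), mul_zero]

lemma lintegral_bracket_rpow (m : ℕ) (r : ℝ) {t : ℝ} (ht : 0 < t) (y : Fin m → ℂ) :
    ∫⁻ x : Fin m → ℂ, ENNReal.ofReal ((t + ∑ j, ‖x j - y j‖ ^ 2) ^ (-r)) =
      ENNReal.ofReal (t ^ (m - r)) * bracketIntegral m r := by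
  have hshift := lintegral_sub_right_eq_self (μ := (volume : Measure (Fin m → ℂ)))
    (fun x => ENNReal.ofReal ((t + ∑ j, ‖x j‖ ^ 2) ^ (-r))) y
  simp only [Pi.sub_apply] at hshift
  have hs : 0 < √t := Real.sqrt_pos.2 ht
  rw [hshift, bracketIntegral, lintegral_eq_of_comp_smul volume hs (a := -(2 * r))
    (g := fun x => ENNReal.ofReal ((1 + ∑ j, ‖x j‖ ^ 2) ^ (-r)))]
  · congr 2
    rw [Module.finrank_pi_fintype, Real.sqrt_eq_rpow, ← Real.rpow_mul ht.le]
    simp only [Complex.finrank_real_complex, Finset.sum_const, Finset.card_univ,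
      Fintype.card_fin, smul_eq_mul, Nat.cast_mul, Nat.cast_ofNat]
    congr 1
    ring
  · intro x
    have hpos : 0 ≤ 1 + ∑ j, ‖x j‖ ^ 2 := by positivity
    rw [← ENNReal.ofReal_mul (by positivity), show -(2 * r) = 2 * -r by ring,
      Real.rpow_mul hs.le, Real.rpow_two, Real.sq_sqrt ht.le, ← Real.mul_rpow ht.le hpos]
    congr 2
    simp only [Pi.smul_apply, norm_smul, mul_pow, Real.norm_of_nonneg hs.le, Real.sq_sqrt ht.le,
      ← Finset.mul_sum]
    ring

lemma halfPlaneIntegral_lt_top {s : ℝ} (hs : 2 < s) : halfPlaneIntegral s < ⊤ := by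
  have hint := integrable_rpow_neg_one_add_norm_sq (E := ℂ) (μ := volume) (r := s)
    (by rw [Complex.finrank_real_complex]; exact_mod_cast hs)
  refine lt_of_le_of_lt ?_ hint.lintegral_lt_top
  refine (setLIntegral_mono' measurableSet_upperHalfPlane fun ζ hζ => ?_).trans
    (setLIntegral_le_lintegral _ _)
  apply ENNReal.ofReal_le_ofReal
  have hζ' : 0 < ζ.im := hζ
  have hle : 1 + ‖ζ‖ ^ 2 ≤ ‖ζ + Complex.I‖ ^ 2 := by
    rw [← Complex.normSq_eq_norm_sq, ← Complex.normSq_eq_norm_sq, Complex.normSq_apply,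
      Complex.normSq_apply]
    simp
    nlinarith
  calc ‖ζ + Complex.I‖ ^ (-s) = (‖ζ + Complex.I‖ ^ 2) ^ (-s / 2) := by
        rw [← Real.rpow_two, ← Real.rpow_mul (norm_nonneg _)]
        congr 1
        ring
    _ ≤ (1 + ‖ζ‖ ^ 2) ^ (-s / 2) :=
        Real.rpow_le_rpow_of_nonpos (by positivity) hle (by linarith)

lemma bracketIntegral_lt_top {m : ℕ} {r : ℝ} (hr : (m : ℝ) < r) : bracketIntegral m r < ⊤ := by
  have hint := integrable_rpow_neg_one_add_norm_sq (E := Fin m → ℂ) (μ := volume) (r := 2 * r)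
    (by
      rw [Module.finrank_pi_fintype]
      simp only [Complex.finrank_real_complex, Finset.sum_const, Finset.card_univ,
        Fintype.card_fin, smul_eq_mul, Nat.cast_mul, Nat.cast_ofNat]
      linarith)
  refine lt_of_le_of_lt (lintegral_mono fun x => ?_) hint.lintegral_lt_top
  apply ENNReal.ofReal_le_ofReal
  have hsum : 0 ≤ ∑ j, ‖x j‖ ^ 2 := by positivity
  have hle : ‖x‖ ^ 2 ≤ ∑ j, ‖x j‖ ^ 2 := by
    refine (Real.le_sqrt (norm_nonneg _) hsum).1 ((pi_norm_le_iff_of_nonneg (Real.sqrt_nonneg _)).2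
      fun i => Real.le_sqrt_of_sq_le ?_)
    exact Finset.single_le_sum (f := fun j => ‖x j‖ ^ 2) (fun j _ => by positivity)
      (Finset.mem_univ i)
  rw [show -(2 * r) / 2 = -r by ring]
  have hm : (0 : ℝ) ≤ m := m.cast_nonneg
  exact Real.rpow_le_rpow_of_nonpos (by positivity) (by linarith) (by linarith)

lemma halfPlaneIntegral_pos (s : ℝ) : 0 < halfPlaneIntegral s := by
  rw [halfPlaneIntegral, setLIntegral_pos_iff (by fun_prop)]
  have hsub : {ζ : ℂ | 0 < ζ.im} ⊆ Function.support
      (fun ζ : ℂ => ENNReal.ofReal (‖ζ + Complex.I‖ ^ (-s))) ∩ {ζ : ℂ | 0 < ζ.im} := by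
    refine fun ζ hζ => ⟨?_, hζ⟩
    have hζ' : 0 < ζ.im := hζ
    have hne : ζ + Complex.I ≠ 0 := fun h => by
      have := congrArg Complex.im h
      simp at this
      linarith
    have : 0 < ‖ζ + Complex.I‖ := norm_pos_iff.2 hne
    simpa using Real.rpow_pos_of_pos this _
  refine lt_of_lt_of_le (IsOpen.measure_pos volume ?_ ⟨Complex.I, by simp⟩) (measure_mono hsub)
  exact isOpen_lt continuous_const Complex.continuous_im

lemma bracketIntegral_pos (m : ℕ) (r : ℝ) : 0 < bracketIntegral m r := by
  rw [bracketIntegral, lintegral_pos_iff_support (by fun_prop)]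
  have hsupp : Function.support
      (fun x : Fin m → ℂ => ENNReal.ofReal ((1 + ∑ j, ‖x j‖ ^ 2) ^ (-r))) = Set.univ := by
    refine Set.eq_univ_of_forall fun x => ?_
    have : 0 < 1 + ∑ j, ‖x j‖ ^ 2 := by positivity
    simpa using Real.rpow_pos_of_pos this _
  rw [hsupp]
  exact isOpen_univ.measure_pos volume Set.univ_nonempty

lemma sum_norm_sub_sq {m : ℕ} (x y : Fin m → ℂ) :
    ∑ j, ‖x j - y j‖ ^ 2 = ∑ j, ‖x j‖ ^ 2 + ∑ j, ‖y j‖ ^ 2 -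
      2 * (∑ j, x j * (starRingEnd ℂ) (y j)).re := by
  rw [Complex.re_sum, Finset.mul_sum, ← Finset.sum_add_distrib, ← Finset.sum_sub_distrib]
  refine Finset.sum_congr rfl fun j _ => ?_
  simp only [← Complex.normSq_eq_norm_sq, Complex.normSq_sub]

/-- In the fibre over `x`, after translating the last coordinate, `ρ(·, z)` is the kernel of the
upper half-plane at height `ρ(z) + |x - z′|²`. -/
lemma srho2_translate {m : ℕ} (z : SPoint m) (x : Fin m → ℂ) (ζ : ℂ) :
    srho2 (x, ζ + ⟨z.2.re - 2 * (∑ j, x j * (starRingEnd ℂ) (z.1 j)).im, ∑ j, ‖x j‖ ^ 2⟩) z =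
      -(Complex.I / 2) * (ζ + ((srho z + ∑ j, ‖x j - z.1 j‖ ^ 2 : ℝ) : ℂ) * Complex.I) := by
  rw [sum_norm_sub_sq]
  simp only [srho2, srho]
  generalize ∑ j, x j * (starRingEnd ℂ) (z.1 j) = X
  generalize ∑ j, ‖x j‖ ^ 2 = A
  apply Complex.ext
  · simp
    ring
  · simp
    ring

lemma continuous_srho {m : ℕ} : Continuous (srho : SPoint m → ℝ) := by
  unfold srho
  fun_prop

lemma isOpen_Siegel (m : ℕ) : IsOpen (Siegel m) := isOpen_lt continuous_const continuous_srho

lemma differentiable_srho2_left {m : ℕ} (z : SPoint m) :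
    Differentiable ℂ fun w : SPoint m => srho2 w z := by
  unfold srho2
  fun_prop

lemma srho2_ne_zero {m : ℕ} {z w : SPoint m} (hz : z ∈ Siegel m) (hw : w ∈ Siegel m) :
    srho2 w z ≠ 0 := by
  obtain ⟨x, η⟩ := w
  have hz' : 0 < srho z := hz
  have hη : 0 < η.im - ∑ j, ‖x j‖ ^ 2 := hw
  have key := srho2_translate z x (η - ⟨z.2.re - 2 * (∑ j, x j * (starRingEnd ℂ) (z.1 j)).im,
    ∑ j, ‖x j‖ ^ 2⟩)
  rw [sub_add_cancel] at key
  rw [key]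
  refine mul_ne_zero (by simp) fun h => ?_
  have hnn : 0 ≤ ∑ j, ‖x j - z.1 j‖ ^ 2 := by positivity
  have him := congrArg Complex.im h
  rw [Complex.add_im, Complex.sub_im] at him
  simp only [Complex.im_ofReal_mul, Complex.I_im, mul_one, Complex.zero_im] at him
  linarith

/-- The scaling law for `∫_𝒰 |ρ(w, z)|^{-s} dV(w)`. -/
lemma lintegral_srho2_rpow {m : ℕ} (s : ℝ) {z : SPoint m} (hz : z ∈ Siegel m) :
    ∫⁻ w in Siegel m, ENNReal.ofReal (‖srho2 w z‖ ^ (-s)) =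
      ENNReal.ofReal (srho z ^ (m + 2 - s)) *
        (ENNReal.ofReal (2 ^ s) * halfPlaneIntegral s * bracketIntegral m (s - 2)) := by
  have hz' : 0 < srho z := hz
  have hmeas : Measurable fun w : SPoint m => ENNReal.ofReal (‖srho2 w z‖ ^ (-s)) := by
    have := (differentiable_srho2_left z).continuous.measurable
    fun_prop
  have hfibre : ∀ x : Fin m → ℂ,
      ∫⁻ η : ℂ, (Siegel m).indicator (fun w => ENNReal.ofReal (‖srho2 w z‖ ^ (-s))) (x, η) =
        ENNReal.ofReal (2 ^ s) * halfPlaneIntegral s *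
          ENNReal.ofReal ((srho z + ∑ j, ‖x j - z.1 j‖ ^ 2) ^ (-(s - 2))) := by
    intro x
    have ht : 0 < srho z + ∑ j, ‖x j - z.1 j‖ ^ 2 := by positivity
    rw [neg_sub, mul_assoc, mul_comm (halfPlaneIntegral s), ← lintegral_halfPlane_rpow s ht,
      ← lintegral_const_mul' _ _ ENNReal.ofReal_ne_top,
      ← lintegral_indicator measurableSet_upperHalfPlane,
      ← lintegral_add_right_eq_self _ (⟨z.2.re - 2 * (∑ j, x j * (starRingEnd ℂ) (z.1 j)).im,
        ∑ j, ‖x j‖ ^ 2⟩ : ℂ)]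
    refine lintegral_congr fun ζ => ?_
    have hmem : (x, ζ + ⟨z.2.re - 2 * (∑ j, x j * (starRingEnd ℂ) (z.1 j)).im,
        ∑ j, ‖x j‖ ^ 2⟩) ∈ Siegel m ↔ ζ ∈ {ζ : ℂ | 0 < ζ.im} := by
      simp [Siegel, srho]
    by_cases hζ : ζ ∈ {ζ : ℂ | 0 < ζ.im}
    · rw [Set.indicator_of_mem hζ, Set.indicator_of_mem (hmem.2 hζ), srho2_translate,
        ← ENNReal.ofReal_mul (by positivity), norm_mul,
        Real.mul_rpow (norm_nonneg _) (norm_nonneg _)]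
      congr 2
      simp [Real.rpow_neg, Real.inv_rpow]
    · rw [Set.indicator_of_notMem hζ, Set.indicator_of_notMem (fun h => hζ (hmem.1 h))]
  rw [← lintegral_indicator (isOpen_Siegel m).measurableSet, Measure.volume_eq_prod,
    lintegral_prod _ (hmeas.indicator (isOpen_Siegel m).measurableSet).aemeasurable]
  simp_rw [hfibre]
  rw [lintegral_const_mul _ (by fun_prop), lintegral_bracket_rpow m _ hz',
    show (m : ℝ) - (s - 2) = m + 2 - s by ring]
  ring

/-- for `1 < p < ∞`, `K_z ∈ Aᵖ(𝒰)` with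
`‖K_z‖ₚ = C_{n,p} ρ(z)^{−(n+1)/p′}`, `p′ = p/(p−1)`. -/
theorem bergman_kernel_norm (n : ℕ) (hn : 1 ≤ n) (p : ℝ) (hp : 1 < p) :
    ∃ C : ℝ, 0 < C ∧ ∀ z ∈ Siegel (n - 1),
      MemAp n p (fun w => sK n w z) ∧
        bNorm n p (fun w => sK n w z) = C * srho z ^ (-((n : ℝ) + 1) / (p / (p - 1))) := by
  have hp0 : 0 < p := by linarith
  have hn1 : (1 : ℝ) ≤ n := by exact_mod_cast hn
  have hm : ((n - 1 : ℕ) : ℝ) = n - 1 := by rw [Nat.cast_sub hn, Nat.cast_one]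
  set s : ℝ := (n + 1) * p with hs
  have hs1 : (n : ℝ) + 1 < s := by nlinarith
  set c : ℝ := ‖(n.factorial : ℂ) / (4 * (Real.pi : ℂ) ^ n)‖ with hc
  have hc0 : 0 < c := by
    rw [hc, norm_pos_iff]
    have : (n.factorial : ℂ) ≠ 0 := by exact_mod_cast n.factorial_ne_zero
    have : (Real.pi : ℂ) ≠ 0 := by exact_mod_cast Real.pi_ne_zero
    simp [*]
  set M : ENNReal := ENNReal.ofReal (2 ^ s) * halfPlaneIntegral s *
    bracketIntegral (n - 1) (s - 2) with hM
  have hMtop : M ≠ ⊤ := ENNReal.mul_ne_top (ENNReal.mul_ne_top ENNReal.ofReal_ne_top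
    (halfPlaneIntegral_lt_top (by linarith)).ne)
    (bracketIntegral_lt_top (by rw [hm]; linarith)).ne
  have hM0 : M ≠ 0 := by
    refine mul_ne_zero (mul_ne_zero ?_ (halfPlaneIntegral_pos s).ne')
      (bracketIntegral_pos _ _).ne'
    simpa using Real.rpow_pos_of_pos two_pos s
  have hMr : 0 < M.toReal := ENNReal.toReal_pos hM0 hMtop
  refine ⟨(c ^ p * M.toReal) ^ (1 / p), by positivity, fun z hz => ?_⟩
  have hz' : 0 < srho z := hz
  have hnorm : ∀ w, ‖sK n w z‖ ^ p = c ^ p * ‖srho2 w z‖ ^ (-s) := fun w => by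
    rw [sK, norm_mul, ← hc, Real.mul_rpow hc0.le (norm_nonneg _), norm_zpow, ← Real.rpow_intCast,
      ← Real.rpow_mul (norm_nonneg _)]
    congr 2
    push_cast
    ring
  have hcont := (differentiable_srho2_left z).continuous.measurable
  have hmeas : Measurable fun w => c ^ p * ‖srho2 w z‖ ^ (-s) := by fun_prop
  have hnn : ∀ w, 0 ≤ c ^ p * ‖srho2 w z‖ ^ (-s) := fun w => by positivity
  have hlint : ∫⁻ w in Siegel (n - 1), ENNReal.ofReal (c ^ p * ‖srho2 w z‖ ^ (-s)) =
      ENNReal.ofReal (c ^ p) * (ENNReal.ofReal (srho z ^ (n + 1 - s)) * M) := by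
    simp_rw [ENNReal.ofReal_mul (Real.rpow_nonneg hc0.le p)]
    rw [lintegral_const_mul' _ _ ENNReal.ofReal_ne_top, lintegral_srho2_rpow s hz, hm,
      show (n : ℝ) - 1 + 2 - s = n + 1 - s by ring]
  refine ⟨⟨?_, ?_⟩, ?_⟩
  · intro w hw
    have hd : DifferentiableAt ℂ (fun w => srho2 w z) w := differentiable_srho2_left z w
    exact ((hd.zpow (Or.inl (srho2_ne_zero hz hw))).const_mul _).differentiableWithinAt
  · simp_rw [IntegrableOn, hnorm]
    refine ⟨hmeas.aestronglyMeasurable, ?_⟩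
    rw [hasFiniteIntegral_iff_ofReal (Eventually.of_forall hnn), hlint]
    exact (ENNReal.mul_ne_top ENNReal.ofReal_ne_top
      (ENNReal.mul_ne_top ENNReal.ofReal_ne_top hMtop)).lt_top
  · simp_rw [bNorm, hnorm]
    rw [integral_eq_lintegral_of_nonneg_ae (Eventually.of_forall hnn)
      hmeas.aestronglyMeasurable, hlint, ENNReal.toReal_mul, ENNReal.toReal_mul,
      ENNReal.toReal_ofReal (by positivity), ENNReal.toReal_ofReal (by positivity),
      mul_left_comm, mul_comm, Real.mul_rpow (by positivity) (by positivity),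
      ← Real.rpow_mul hz'.le]
    congr 2
    rw [hs]
    have : p - 1 ≠ 0 := by linarith
    field_simp
    ring
end

section
/- For any r > 0 there exists a sequence (a_k) of points of 𝒰 such that (i) 𝒰 = ⋃_{k=1}^∞ D(a_k, r), and (ii) there is a positive integer N such that each point z ∈ 𝒰 belongs to at most N of the balls D(a_k, 2r). -/
open MeasureTheory Filter

noncomputable section

/-- The real and imaginary parts of `2ρ(z,w)` in terms of the heights `ρ(z)`, `ρ(w)`. -/
theorem four_mul_norm_srho2_sq {m : ℕ} (z w : SPoint m) :
    4 * ‖srho2 z w‖ ^ 2 =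
      (srho z + srho w + ∑ j, ‖z.1 j - w.1 j‖ ^ 2) ^ 2 +
      (w.2.re - 2 * (∑ j, z.1 j * (starRingEnd ℂ) (w.1 j)).im - z.2.re) ^ 2 := by
  have hsum : ∑ j, ‖z.1 j - w.1 j‖ ^ 2 = ∑ j, ‖z.1 j‖ ^ 2 + ∑ j, ‖w.1 j‖ ^ 2 -
      2 * (∑ j, z.1 j * (starRingEnd ℂ) (w.1 j)).re := by
    rw [Complex.re_sum, Finset.mul_sum, ← Finset.sum_add_distrib, ← Finset.sum_sub_distrib]
    refine Finset.sum_congr rfl fun j _ => ?_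
    simp only [← Complex.normSq_eq_norm_sq, Complex.normSq_apply, Complex.sub_re, Complex.sub_im,
      Complex.mul_re, Complex.conj_re, Complex.conj_im]
    ring
  rw [hsum, ← Complex.normSq_eq_norm_sq, Complex.normSq_apply]
  unfold srho2 srho
  generalize (∑ j, z.1 j * (starRingEnd ℂ) (w.1 j)) = S
  simp
  ring

/-- The constant `cosh² R`, written through `exp (2R)`. -/
def ballConst (R : ℝ) : ℝ := (Real.exp (2 * R) + 1) ^ 2 / (4 * Real.exp (2 * R))

theorem one_lt_ballConst {R : ℝ} (hR : 0 < R) : 1 < ballConst R := by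
  have hE : 1 < Real.exp (2 * R) := Real.one_lt_exp_iff.2 (by linarith)
  unfold ballConst
  rw [lt_div_iff₀ (by positivity)]
  nlinarith [sq_pos_of_pos (sub_pos.2 hE)]

theorem artanh_sqrt_one_sub_lt_iff {q R : ℝ} (hq : 0 < q) (hq1 : q ≤ 1) (hR : 0 < R) :
    artanh (Real.sqrt (1 - q)) < R ↔ 1 < ballConst R * q := by
  set x := Real.sqrt (1 - q) with hx
  have hx0 : 0 ≤ x := Real.sqrt_nonneg _
  have hxsq : x ^ 2 = 1 - q := Real.sq_sqrt (by linarith)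
  have hx1 : x < 1 := by nlinarith
  have hE : 1 < Real.exp (2 * R) := Real.one_lt_exp_iff.2 (by linarith)
  have hlog : artanh x < R ↔ Real.log ((1 + x) / (1 - x)) < 2 * R := by
    unfold artanh
    constructor <;> intro h <;> linarith
  rw [hlog, Real.log_lt_iff_lt_exp (div_pos (by linarith) (by linarith)),
    div_lt_iff₀ (by linarith)]
  unfold ballConst
  set E := Real.exp (2 * R)
  rw [div_mul_eq_mul_div, lt_div_iff₀ (by positivity)]
  have hq' : q = 1 - x ^ 2 := by linarith
  rw [hq']
  have hfac : (E + 1) ^ 2 * (1 - x ^ 2) - 1 * (4 * E) =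
      ((E - 1) - x * (E + 1)) * ((E - 1) + x * (E + 1)) := by ring
  have hpos : 0 < (E - 1) + x * (E + 1) := by nlinarith
  constructor
  · intro h
    have := mul_pos (show 0 < (E - 1) - x * (E + 1) by linarith) hpos
    linarith
  · intro h
    have := pos_of_mul_pos_left (hfac ▸ sub_pos.2 h) hpos.le
    linarith

theorem mem_sball_iff {m : ℕ} {z w : SPoint m} (hz : z ∈ Siegel m) (hw : w ∈ Siegel m)
    {R : ℝ} (hR : 0 < R) :
    w ∈ sball z R ↔
      (srho z + srho w + ∑ j, ‖z.1 j - w.1 j‖ ^ 2) ^ 2 +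
      (w.2.re - 2 * (∑ j, z.1 j * (starRingEnd ℂ) (w.1 j)).im - z.2.re) ^ 2 <
        4 * ballConst R * (srho z * srho w) := by
  have hz' : 0 < srho z := hz
  have hw' : 0 < srho w := hw
  have hprod : 0 < srho z * srho w := mul_pos hz' hw'
  have hle : srho z * srho w ≤ ‖srho2 z w‖ ^ 2 := by
    have h := four_mul_norm_srho2_sq z w
    have hs : 0 ≤ ∑ j, ‖z.1 j - w.1 j‖ ^ 2 := Finset.sum_nonneg fun j _ => by positivity
    nlinarith [sq_nonneg (srho z - srho w), mul_nonneg hz'.le hs, mul_nonneg hw'.le hs,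
      sq_nonneg (w.2.re - 2 * (∑ j, z.1 j * (starRingEnd ℂ) (w.1 j)).im - z.2.re)]
  have hn : 0 < ‖srho2 z w‖ ^ 2 := hprod.trans_le hle
  rw [← four_mul_norm_srho2_sq]
  have hmem : w ∈ sball z R ↔ sbeta z w < R := ⟨fun h => h.2, fun h => ⟨hw, h⟩⟩
  rw [hmem, sbeta, artanh_sqrt_one_sub_lt_iff (div_pos hprod hn) ((div_le_one hn).2 hle) hR,
    ← mul_div_assoc, lt_div_iff₀ hn]
  constructor <;> intro h <;> linarith

/-- The indices of the lattice: height, horizontal position, and real part of `zₙ`. -/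
abbrev LatticeIndex (m : ℕ) := ℤ × (Fin m → ℤ × ℤ) × ℤ

/-- Horizontal part of a lattice point. -/
def latticeHoriz {m : ℕ} (ε : ℝ) (k : ℤ) (p : Fin m → ℤ × ℤ) (j : Fin m) : ℂ :=
  ⟨ε * Real.exp (ε * k / 2) * (p j).1, ε * Real.exp (ε * k / 2) * (p j).2⟩

/-- The lattice point of height `exp (ε k)`; its grid is scaled by the anisotropic dilations
of the Siegel half-space. -/
def latticePoint {m : ℕ} (ε : ℝ) (i : LatticeIndex m) : SPoint m :=
  (latticeHoriz ε i.1 i.2.1,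
    ⟨ε * Real.exp (ε * i.1) * i.2.2,
      Real.exp (ε * i.1) + ∑ j, ‖latticeHoriz ε i.1 i.2.1 j‖ ^ 2⟩)

theorem srho_latticePoint {m : ℕ} (ε : ℝ) (i : LatticeIndex m) :
    srho (latticePoint ε i) = Real.exp (ε * i.1) := by
  simp [srho, latticePoint]

theorem latticePoint_mem {m : ℕ} (ε : ℝ) (i : LatticeIndex m) :
    latticePoint ε i ∈ Siegel m := by
  change 0 < srho _
  rw [srho_latticePoint]
  positivity

theorem exp_half_sq (x : ℝ) : Real.exp (x / 2) ^ 2 = Real.exp x := by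
  rw [← Real.exp_nat_mul]
  congr 1
  push_cast
  ring

theorem sq_mul_floor_div_sub_le {c : ℝ} (hc : 0 < c) (x : ℝ) :
    (c * (⌊x / c⌋ : ℝ) - x) ^ 2 ≤ c ^ 2 := by
  have h1 := (le_div_iff₀ hc).1 (Int.floor_le (x / c))
  have h2 := (div_lt_iff₀ hc).1 (Int.lt_floor_add_one (x / c))
  nlinarith

theorem exists_latticePoint_ball {m : ℕ} {ε R : ℝ} (hε : 0 < ε) (hR : 0 < R)
    (hsmall : (1 + Real.exp ε + m * (2 * ε ^ 2)) ^ 2 + ε ^ 2 < 4 * ballConst R)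
    {w : SPoint m} (hw : w ∈ Siegel m) : ∃ i, w ∈ sball (latticePoint ε i) R := by
  have hw' : 0 < srho w := hw
  set k : ℤ := ⌊Real.log (srho w) / ε⌋ with hk
  set h := Real.exp (ε * k) with hh
  set c := ε * Real.exp (ε * k / 2) with hc
  have hh0 : 0 < h := Real.exp_pos _
  have hc0 : 0 < c := by positivity
  have hcsq : c ^ 2 = ε ^ 2 * h := by rw [hc, mul_pow, exp_half_sq]
  have hle : h ≤ srho w := by
    rw [hh, ← Real.le_log_iff_exp_le hw', mul_comm, ← le_div_iff₀ hε]
    exact Int.floor_le _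
  have hlt : srho w ≤ Real.exp ε * h := by
    rw [hh, ← Real.exp_add, ← Real.log_le_iff_le_exp hw']
    have := (div_lt_iff₀ hε).1 (Int.lt_floor_add_one (Real.log (srho w) / ε))
    rw [← hk] at this
    linarith
  let p : Fin m → ℤ × ℤ := fun j => (⌊(w.1 j).re / c⌋, ⌊(w.1 j).im / c⌋)
  set y := w.2.re - 2 * (∑ j, latticeHoriz ε k p j * (starRingEnd ℂ) (w.1 j)).im with hy
  refine ⟨(k, p, ⌊y / (ε * h)⌋), ?_⟩
  rw [mem_sball_iff (latticePoint_mem _ _) hw hR, srho_latticePoint]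
  change (h + srho w + ∑ j, ‖latticeHoriz ε k p j - w.1 j‖ ^ 2) ^ 2 +
    (y - ε * h * (⌊y / (ε * h)⌋ : ℝ)) ^ 2 < 4 * ballConst R * (h * srho w)
  have hs0 : 0 ≤ ∑ j, ‖latticeHoriz ε k p j - w.1 j‖ ^ 2 :=
    Finset.sum_nonneg fun j _ => by positivity
  have hs : ∑ j, ‖latticeHoriz ε k p j - w.1 j‖ ^ 2 ≤ m * (2 * ε ^ 2) * h := by
    have : ∀ j ∈ Finset.univ, ‖latticeHoriz ε k p j - w.1 j‖ ^ 2 ≤ 2 * ε ^ 2 * h := by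
      intro j _
      rw [← Complex.normSq_eq_norm_sq, Complex.normSq_apply, Complex.sub_re, Complex.sub_im]
      have h1 := sq_mul_floor_div_sub_le hc0 (w.1 j).re
      have h2 := sq_mul_floor_div_sub_le hc0 (w.1 j).im
      change (c * (⌊(w.1 j).re / c⌋ : ℝ) - (w.1 j).re) * (c * (⌊(w.1 j).re / c⌋ : ℝ) - (w.1 j).re)
        + (c * (⌊(w.1 j).im / c⌋ : ℝ) - (w.1 j).im) * (c * (⌊(w.1 j).im / c⌋ : ℝ) - (w.1 j).im) ≤ _
      nlinarith
    refine (Finset.sum_le_card_nsmul _ _ _ this).trans_eq ?_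
    simp
    ring
  have ht : (y - ε * h * (⌊y / (ε * h)⌋ : ℝ)) ^ 2 ≤ ε ^ 2 * h ^ 2 := by
    have := sq_mul_floor_div_sub_le (mul_pos hε hh0) y
    nlinarith
  have hsq : (h + srho w + ∑ j, ‖latticeHoriz ε k p j - w.1 j‖ ^ 2) ^ 2 ≤
      ((1 + Real.exp ε + m * (2 * ε ^ 2)) * h) ^ 2 := by
    apply pow_le_pow_left₀ (by positivity)
    linarith
  have hC : 0 < ballConst R := one_pos.trans (one_lt_ballConst hR)
  calc _ ≤ ((1 + Real.exp ε + m * (2 * ε ^ 2)) ^ 2 + ε ^ 2) * h ^ 2 := by linarith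
    _ < 4 * ballConst R * h ^ 2 := by gcongr
    _ ≤ 4 * ballConst R * (h * srho w) := by rw [sq]; gcongr

theorem exists_small_mesh (m : ℕ) {C : ℝ} (hC : 1 < C) :
    ∃ ε : ℝ, 0 < ε ∧ (1 + Real.exp ε + m * (2 * ε ^ 2)) ^ 2 + ε ^ 2 < 4 * C := by
  have hcont : Continuous fun ε : ℝ => (1 + Real.exp ε + m * (2 * ε ^ 2)) ^ 2 + ε ^ 2 := by
    fun_prop
  have hev := hcont.continuousAt.eventually_lt (continuousAt_const (y := 4 * C) (x := (0 : ℝ)))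
    (by norm_num; linarith)
  obtain ⟨ε, h1, h2⟩ :=
    ((hev.filter_mono nhdsWithin_le_nhds).and (self_mem_nhdsWithin (s := Set.Ioi (0 : ℝ)))).exists
  exact ⟨ε, h2, h1⟩

theorem sub_floor_mem_Icc {k : ℤ} {x : ℝ} {M : ℕ} (h : |(k : ℝ) - x| ≤ M) :
    k - ⌊x⌋ ∈ Finset.Icc (-(M : ℤ)) (M + 1) := by
  obtain ⟨h1, h2⟩ := abs_le.1 h
  have h3 := Int.floor_le x
  have h4 := Int.lt_floor_add_one x
  rw [Finset.mem_Icc]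
  constructor
  · have : (-(M : ℝ)) ≤ k - ⌊x⌋ := by linarith
    exact_mod_cast this
  · have : (k : ℝ) - ⌊x⌋ ≤ M + 1 := by linarith
    exact_mod_cast this

theorem abs_sub_div_le {c x L B : ℝ} (k : ℤ) (hc : 0 < c) (h : |c * k - x| ≤ B)
    (hB : B ≤ L * c) : |(k : ℝ) - x / c| ≤ L := by
  have : (k : ℝ) - x / c = (c * k - x) / c := by field_simp
  rw [this, abs_div, abs_of_pos hc, div_le_iff₀ hc]
  exact h.trans hB

/-- Displacement of a lattice index from the index of the cell containing `w`. -/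
def relIndex {m : ℕ} (ε : ℝ) (w : SPoint m) (i : LatticeIndex m) : LatticeIndex m :=
  (i.1 - ⌊Real.log (srho w) / ε⌋,
    fun j => ((i.2.1 j).1 - ⌊(w.1 j).re / (ε * Real.exp (ε * i.1 / 2))⌋,
      (i.2.1 j).2 - ⌊(w.1 j).im / (ε * Real.exp (ε * i.1 / 2))⌋),
    i.2.2 - ⌊(w.2.re - 2 * (∑ j, latticeHoriz ε i.1 i.2.1 j * (starRingEnd ℂ) (w.1 j)).im) /
      (ε * Real.exp (ε * i.1))⌋)

theorem relIndex_injective {m : ℕ} (ε : ℝ) (w : SPoint m) :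
    Function.Injective (relIndex ε w) := by
  rintro ⟨k, p, t⟩ ⟨k', p', t'⟩ h
  simp only [relIndex, Prod.mk.injEq] at h
  obtain ⟨hk, hp, ht⟩ := h
  obtain rfl : k = k' := by linarith
  obtain rfl : p = p' := by
    funext j
    have hj := congrFun hp j
    simp only [Prod.mk.injEq] at hj
    exact Prod.ext (by linarith [hj.1]) (by linarith [hj.2])
  obtain rfl : t = t' := by linarith
  rfl

/-- The box of lattice indices with all coordinates in `[-M, M + 1]`. -/
def indexBox (m M : ℕ) : Finset (LatticeIndex m) :=
  let I := Finset.Icc (-(M : ℤ)) (M + 1)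
  I ×ˢ (Fintype.piFinset fun _ : Fin m => I ×ˢ I) ×ˢ I

theorem relIndex_mem_indexBox {m M : ℕ} {ε R : ℝ} (hε : 0 < ε) (hR : 0 < R)
    (hM : 4 * ballConst R / ε ≤ M) {w : SPoint m} (hw : w ∈ Siegel m) {i : LatticeIndex m}
    (hi : w ∈ sball (latticePoint ε i) R) : relIndex ε w i ∈ indexBox m M := by
  have hw' : 0 < srho w := hw
  rw [mem_sball_iff (latticePoint_mem _ _) hw hR, srho_latticePoint] at hi
  obtain ⟨k, p, t⟩ := i
  set y := w.2.re - 2 * (∑ j, latticeHoriz ε k p j * (starRingEnd ℂ) (w.1 j)).im with hy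
  set h := Real.exp (ε * k) with hh
  set g := srho w with hg
  set C := ballConst R with hC
  change (h + g + ∑ j, ‖latticeHoriz ε k p j - w.1 j‖ ^ 2) ^ 2 +
    (y - ε * h * t) ^ 2 < 4 * C * (h * g) at hi
  have hC1 : 1 < C := one_lt_ballConst hR
  have hh0 : 0 < h := Real.exp_pos _
  set s := ∑ j, ‖latticeHoriz ε k p j - w.1 j‖ ^ 2 with hs
  have hs0 : 0 ≤ s := Finset.sum_nonneg fun j _ => by positivity
  have hMε : 4 * C ≤ M * ε := (div_le_iff₀ hε).1 hM
  have hhs : 0 ≤ h * s := by positivity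
  have hgs : 0 ≤ g * s := by positivity
  have hgh : g < 4 * C * h := by
    refine lt_of_mul_lt_mul_left (a := g) ?_ hw'.le
    nlinarith [sq_nonneg (y - ε * h * t), mul_pos hh0 hw', sq_nonneg s]
  have hhg : h < 4 * C * g := by
    refine lt_of_mul_lt_mul_left (a := h) ?_ hh0.le
    nlinarith [sq_nonneg (y - ε * h * t), mul_pos hh0 hw', sq_nonneg s]
  have hprod : 4 * C * (h * g) ≤ (4 * C * h) ^ 2 := by
    nlinarith [mul_le_mul_of_nonneg_left hgh.le (show 0 ≤ 4 * C * h by positivity)]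
  have hsC : s ≤ 4 * C * h := by
    refine (pow_le_pow_iff_left₀ hs0 (by positivity) two_ne_zero).1 ?_
    nlinarith [sq_nonneg (y - ε * h * t), sq_nonneg (h + g), mul_pos hh0 hw']
  have ht : |ε * h * t - y| ≤ 4 * C * h := by
    refine abs_le_of_sq_le_sq ?_ (by positivity)
    nlinarith [sq_nonneg (h + g + s)]
  have hlogC : Real.log (4 * C) ≤ 4 * C := (Real.log_le_self (by positivity))
  have hk : |ε * k - Real.log g| ≤ 4 * C := by
    have h1 := Real.log_lt_log hw' hgh
    have h2 := Real.log_lt_log hh0 hhg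
    rw [Real.log_mul (by positivity) (by positivity), hh, Real.log_exp] at h1
    rw [Real.log_mul (by positivity) (by positivity), hh, Real.log_exp] at h2
    rw [abs_le]
    constructor <;> linarith
  set c := ε * Real.exp (ε * k / 2) with hc
  have hc0 : 0 < c := by positivity
  have hcsq : c ^ 2 = ε ^ 2 * h := by rw [hc, mul_pow, exp_half_sq]
  have hbound : 4 * C * h ≤ (M * c) ^ 2 := by
    rw [mul_pow, hcsq]
    nlinarith [mul_le_mul_of_nonneg_right (show 4 * C ≤ (M * ε) ^ 2 by nlinarith) hh0.le]
  have hp : ∀ j, ‖latticeHoriz ε k p j - w.1 j‖ ≤ M * c := fun j => by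
    refine (pow_le_pow_iff_left₀ (norm_nonneg _) (by positivity) two_ne_zero).1 ?_
    refine le_trans ?_ (hsC.trans hbound)
    exact Finset.single_le_sum (f := fun j => ‖latticeHoriz ε k p j - w.1 j‖ ^ 2)
      (fun j _ => by positivity) (Finset.mem_univ j)
  simp only [indexBox, Finset.mem_product, Fintype.mem_piFinset]
  refine ⟨sub_floor_mem_Icc (abs_sub_div_le k hε hk hMε), fun j => ⟨?_, ?_⟩, ?_⟩
  · exact sub_floor_mem_Icc
      (abs_sub_div_le _ hc0 ((Complex.abs_re_le_norm _).trans (hp j)) le_rfl)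
  · exact sub_floor_mem_Icc
      (abs_sub_div_le _ hc0 ((Complex.abs_im_le_norm _).trans (hp j)) le_rfl)
  · refine sub_floor_mem_Icc (abs_sub_div_le _ (mul_pos hε hh0) ht ?_)
    nlinarith

end

/-- for any `r > 0` there is an `r`-lattice `(a_k)` in the Bergman metric:
`𝒰 = ⋃ₖ D(a_k, r)` and some `N ≥ 1` bounds the multiplicity of the cover by `D(a_k, 2r)`. -/
theorem bergman_lattice (n : ℕ) (hn : 1 ≤ n) (r : ℝ) (hr : 0 < r) :
    ∃ a : ℕ → SPoint (n - 1),
      (∀ k, a k ∈ Siegel (n - 1)) ∧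
      Siegel (n - 1) = ⋃ k, sball (a k) r ∧
      ∃ N : ℕ, 0 < N ∧ ∀ z ∈ Siegel (n - 1),
        ({k : ℕ | z ∈ sball (a k) (2 * r)}).Finite ∧
        ({k : ℕ | z ∈ sball (a k) (2 * r)}).ncard ≤ N := by
  obtain ⟨ε, hε, hsmall⟩ := exists_small_mesh (n - 1) (one_lt_ballConst hr)
  obtain ⟨e⟩ : Nonempty (ℕ ≃ LatticeIndex (n - 1)) := nonempty_equiv_of_countable
  obtain ⟨M, hM⟩ := exists_nat_ge (4 * ballConst (2 * r) / ε)
  refine ⟨fun k => latticePoint ε (e k), fun k => latticePoint_mem _ _, ?_,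
    (indexBox (n - 1) M).card + 1, Nat.succ_pos _, fun z hz => ?_⟩
  · refine Set.Subset.antisymm (fun w hw => ?_) (Set.iUnion_subset fun k w hw => hw.1)
    obtain ⟨i, hi⟩ := exists_latticePoint_ball hε hr hsmall hw
    exact Set.mem_iUnion.2 ⟨e.symm i, by simpa using hi⟩
  · have hmaps : ∀ k ∈ {k : ℕ | z ∈ sball (latticePoint ε (e k)) (2 * r)},
        relIndex ε z (e k) ∈ (indexBox (n - 1) M : Set (LatticeIndex (n - 1))) := fun k hk =>
      relIndex_mem_indexBox hε (by positivity) hM hz hk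
    have hinj : Function.Injective fun k => relIndex ε z (e k) :=
      (relIndex_injective ε z).comp e.injective
    refine ⟨Set.Finite.of_injOn hmaps hinj.injOn (Finset.finite_toSet _), ?_⟩
    have := Set.ncard_le_ncard_of_injOn _ hmaps hinj.injOn (Finset.finite_toSet _)
    rw [Set.ncard_coe_finset] at this
    exact this.trans (Nat.le_succ _)
end

section
/- Given r > 0, the inequalities (1 − tanh r)/(1 + tanh r) ≤ |ρ(z,u)|/|ρ(z,v)| ≤ (1 + tanh r)/(1 − tanh r) hold for all z, u, v ∈ 𝒰 with β(u,v) ≤ r. -/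
open MeasureTheory Filter

/-- The polarised form `ρ(z,u)` in coordinates centred at `v`. -/
lemma srho2_eq_centered {m : ℕ} (z u v : SPoint m) :
    srho2 z u = srho2 z v + (starRingEnd ℂ) (srho2 u v) - (srho v : ℂ) -
      ∑ j, (z.1 j - v.1 j) * (starRingEnd ℂ) (u.1 j - v.1 j) := by
  have him : (v.2.im : ℂ) = Complex.I / 2 * ((starRingEnd ℂ) v.2 - v.2) := by
    apply Complex.ext <;> simp
    ring
  have hsum : ∑ j, (z.1 j - v.1 j) * (starRingEnd ℂ) (u.1 j - v.1 j) =
      ∑ j, z.1 j * (starRingEnd ℂ) (u.1 j) - ∑ j, z.1 j * (starRingEnd ℂ) (v.1 j) -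
        ∑ j, v.1 j * (starRingEnd ℂ) (u.1 j) + ∑ j, v.1 j * (starRingEnd ℂ) (v.1 j) := by
    simp only [← Finset.sum_sub_distrib, ← Finset.sum_add_distrib, map_sub]
    exact Finset.sum_congr rfl fun j _ => by ring
  rw [hsum]
  simp only [srho2, srho, Complex.ofReal_sub, Complex.ofReal_sum, Complex.ofReal_pow, him,
    ← Complex.mul_conj', map_sub, map_mul, map_div₀, map_sum, Complex.conj_conj, Complex.conj_I,
    map_ofNat, mul_comm ((starRingEnd ℂ) (u.1 _)) (v.1 _)]
  ring

lemma srho2_self {m : ℕ} (z : SPoint m) : srho2 z z = (srho z : ℂ) := by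
  have h := srho2_eq_centered z z z
  simp only [sub_self, zero_mul, Finset.sum_const_zero, sub_zero] at h
  have h' : (starRingEnd ℂ) (srho2 z z) = (srho z : ℂ) := by linear_combination -h
  simpa using congrArg (starRingEnd ℂ) h'

/-- The form `ρ(z)` in coordinates centred at `v`. -/
lemma srho_eq_centered {m : ℕ} (z v : SPoint m) :
    srho z = 2 * (srho2 z v).re - srho v - ∑ j, ‖z.1 j - v.1 j‖ ^ 2 := by
  have h := srho2_eq_centered z z v
  simp only [srho2_self, Complex.mul_conj', Complex.add_conj] at h
  exact_mod_cast h

lemma norm_srho2_sq_sub {m : ℕ} (z v : SPoint m) :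
    ‖srho2 z v‖ ^ 2 - srho z * srho v =
      ‖srho2 z v - srho v‖ ^ 2 + srho v * ∑ j, ‖z.1 j - v.1 j‖ ^ 2 := by
  rw [srho_eq_centered z v, ← Complex.normSq_eq_norm_sq, ← Complex.normSq_eq_norm_sq,
    Complex.normSq_apply, Complex.normSq_apply]
  simp only [Complex.sub_re, Complex.sub_im, Complex.ofReal_re, Complex.ofReal_im]
  ring

lemma norm_srho2_pos {m : ℕ} {z v : SPoint m} (hz : 0 < srho z) (hv : 0 < srho v) :
    0 < ‖srho2 z v‖ := by
  have hsum : 0 ≤ ∑ j, ‖z.1 j - v.1 j‖ ^ 2 := by positivity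
  have hre : 0 < (srho2 z v).re := by linarith [srho_eq_centered z v]
  exact hre.trans_le (Complex.re_le_norm _)

/-- Cauchy–Schwarz for a sum of one term and a weighted sum. -/
lemma add_mul_sq_le {X Y A B S h : ℝ} (hA : 0 ≤ A) (hB : 0 ≤ B) (hh : 0 ≤ h)
    (hS : S ^ 2 ≤ A * B) :
    (X * Y + h * S) ^ 2 ≤ (X ^ 2 + h * A) * (Y ^ 2 + h * B) := by
  have hcross : 2 * (X * Y * S) ≤ X ^ 2 * B + Y ^ 2 * A := by
    refine le_of_abs_le (abs_le_of_sq_le_sq ?_ (by positivity))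
    nlinarith [mul_le_mul_of_nonneg_left hS (sq_nonneg (X * Y)),
      sq_nonneg (X ^ 2 * B - Y ^ 2 * A)]
  nlinarith [mul_le_mul_of_nonneg_left hcross hh, mul_le_mul_of_nonneg_left hS (sq_nonneg h)]

/-- Cauchy–Schwarz inequality on the negative definite orthogonal complement of `v`. -/
lemma norm_srho_mul_srho2_sub_sq_le {m : ℕ} (z u v : SPoint m) (hv : 0 ≤ srho v) :
    ‖srho v * srho2 z u - srho2 z v * (starRingEnd ℂ) (srho2 u v)‖ ^ 2 ≤
      (‖srho2 z v‖ ^ 2 - srho z * srho v) * (‖srho2 u v‖ ^ 2 - srho u * srho v) := by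
  have hS : (∑ j, ‖z.1 j - v.1 j‖ * ‖u.1 j - v.1 j‖) ^ 2 ≤
      (∑ j, ‖z.1 j - v.1 j‖ ^ 2) * ∑ j, ‖u.1 j - v.1 j‖ ^ 2 :=
    Finset.sum_mul_sq_le_sq_mul_sq _ _ _
  have hsum : ‖∑ j, (z.1 j - v.1 j) * (starRingEnd ℂ) (u.1 j - v.1 j)‖ ≤
      ∑ j, ‖z.1 j - v.1 j‖ * ‖u.1 j - v.1 j‖ :=
    (norm_sum_le _ _).trans_eq (Finset.sum_congr rfl fun j _ => by
      rw [norm_mul, Complex.norm_conj])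
  have heq : srho v * srho2 z u - srho2 z v * (starRingEnd ℂ) (srho2 u v) =
      -((srho2 z v - srho v) * (starRingEnd ℂ) (srho2 u v - srho v) +
        srho v * ∑ j, (z.1 j - v.1 j) * (starRingEnd ℂ) (u.1 j - v.1 j)) := by
    rw [srho2_eq_centered z u v, map_sub (starRingEnd ℂ) (srho2 u v), Complex.conj_ofReal]
    ring
  have hnorm : ‖srho v * srho2 z u - srho2 z v * (starRingEnd ℂ) (srho2 u v)‖ ≤
      ‖srho2 z v - srho v‖ * ‖srho2 u v - srho v‖ +
        srho v * ∑ j, ‖z.1 j - v.1 j‖ * ‖u.1 j - v.1 j‖ := by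
    rw [heq, norm_neg]
    refine (norm_add_le _ _).trans ?_
    rw [norm_mul, norm_mul, Complex.norm_conj, Complex.norm_real, Real.norm_of_nonneg hv]
    gcongr
  rw [norm_srho2_sq_sub, norm_srho2_sq_sub]
  exact (pow_le_pow_left₀ (norm_nonneg _) hnorm 2).trans
    (add_mul_sq_le (by positivity) (by positivity) hv hS)

/-- The quotient estimate in terms of a bound `t` for the pseudo-hyperbolic distance of
`u` and `v`. -/
lemma srho2_quotient_bounds {m : ℕ} {z u v : SPoint m} (hz : 0 < srho z) (hu : 0 < srho u)
    (hv : 0 < srho v) {t : ℝ} (ht0 : 0 ≤ t) (ht1 : t < 1)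
    (ht : ‖srho2 u v‖ ^ 2 - srho u * srho v ≤ t ^ 2 * ‖srho2 u v‖ ^ 2) :
    (1 - t) / (1 + t) ≤ ‖srho2 z u‖ / ‖srho2 z v‖ ∧
      ‖srho2 z u‖ / ‖srho2 z v‖ ≤ (1 + t) / (1 - t) := by
  have hp := norm_srho2_pos hz hv
  have hq := norm_srho2_pos hu hv
  have hsum : 0 ≤ ∑ j, ‖u.1 j - v.1 j‖ ^ 2 := by positivity
  have hdist : ‖srho2 u v - srho v‖ ≤ t * ‖srho2 u v‖ := by
    refine le_of_abs_le (abs_le_of_sq_le_sq ?_ (by positivity))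
    nlinarith [norm_srho2_sq_sub u v, mul_nonneg hv.le hsum]
  have hmain : ‖srho v * srho2 z u - srho2 z v * (starRingEnd ℂ) (srho2 u v)‖ ≤
      t * (‖srho2 z v‖ * ‖srho2 u v‖) := by
    refine le_of_abs_le (abs_le_of_sq_le_sq ?_ (by positivity))
    calc _ ≤ _ := norm_srho_mul_srho2_sub_sq_le z u v hv.le
      _ ≤ ‖srho2 z v‖ ^ 2 * (t ^ 2 * ‖srho2 u v‖ ^ 2) := by
        refine mul_le_mul (by nlinarith [mul_pos hz hv]) ht ?_ (by positivity)
        rw [norm_srho2_sq_sub]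
        positivity
      _ = _ := by ring
  have hdist' := (abs_norm_sub_norm_le _ _).trans hdist
  have hmain' := (abs_norm_sub_norm_le _ _).trans hmain
  rw [Complex.norm_real, Real.norm_of_nonneg hv.le, abs_le] at hdist'
  rw [norm_mul, norm_mul, Complex.norm_conj, Complex.norm_real, Real.norm_of_nonneg hv.le,
    abs_le] at hmain'
  set p := ‖srho2 z v‖
  set q := ‖srho2 u v‖
  set a := ‖srho2 z u‖
  set h := srho v
  rw [div_le_div_iff₀ (by linarith) hp, div_le_div_iff₀ hp (by linarith)]
  constructor
  · refine le_of_mul_le_mul_left ?_ hv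
    calc h * ((1 - t) * p) ≤ ((1 + t) * q) * ((1 - t) * p) := by
          refine mul_le_mul_of_nonneg_right (by linarith) ?_
          exact mul_nonneg (by linarith) hp.le
      _ = (1 + t) * (p * q - t * (p * q)) := by ring
      _ ≤ (1 + t) * (h * a) := mul_le_mul_of_nonneg_left (by linarith) (by linarith)
      _ = h * (a * (1 + t)) := by ring
  · refine le_of_mul_le_mul_left ?_ hv
    calc h * (a * (1 - t)) = (1 - t) * (h * a) := by ring
      _ ≤ (1 - t) * (p * q + t * (p * q)) :=
        mul_le_mul_of_nonneg_left (by linarith) (by linarith)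
      _ = ((1 - t) * q) * ((1 + t) * p) := by ring
      _ ≤ h * ((1 + t) * p) := by
          refine mul_le_mul_of_nonneg_right (by linarith) ?_
          exact mul_nonneg (by linarith) hp.le

lemma norm_srho2_sq_sub_le_of_sbeta_le {m : ℕ} {u v : SPoint m} (hu : 0 < srho u)
    (hv : 0 < srho v) {r : ℝ} (h : sbeta u v ≤ r) :
    ‖srho2 u v‖ ^ 2 - srho u * srho v ≤ Real.tanh r ^ 2 * ‖srho2 u v‖ ^ 2 := by
  have hq := norm_srho2_pos hu hv
  have hx0 : 0 ≤ 1 - srho u * srho v / ‖srho2 u v‖ ^ 2 := by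
    rw [sub_nonneg, div_le_one (by positivity), ← sub_nonneg, norm_srho2_sq_sub]
    positivity
  have hs1 : Real.sqrt (1 - srho u * srho v / ‖srho2 u v‖ ^ 2) < 1 := by
    rw [Real.sqrt_lt' one_pos]
    have : 0 < srho u * srho v / ‖srho2 u v‖ ^ 2 := by positivity
    linarith
  have hs := Real.sq_sqrt hx0
  have hs0 := Real.sqrt_nonneg (1 - srho u * srho v / ‖srho2 u v‖ ^ 2)
  rw [sbeta] at h
  set s := Real.sqrt (1 - srho u * srho v / ‖srho2 u v‖ ^ 2)
  rw [artanh, ← Real.artanh_eq_half_log ⟨by linarith, hs1.le⟩, ← Real.artanh_tanh r,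
    Real.artanh_le_artanh_iff ⟨by linarith, hs1⟩
      ⟨Real.neg_one_lt_tanh r, Real.tanh_lt_one r⟩] at h
  calc _ = s ^ 2 * ‖srho2 u v‖ ^ 2 := by
        rw [hs]
        field_simp
    _ ≤ _ := by gcongr

/-- for `β(u,v) ≤ r`,
`(1 − tanh r)/(1 + tanh r) ≤ |ρ(z,u)|/|ρ(z,v)| ≤ (1 + tanh r)/(1 − tanh r)`. -/
theorem rho2_quotient_estimate (n : ℕ) (hn : 1 ≤ n) (r : ℝ) (hr : 0 < r)
    (z u v : SPoint (n - 1)) (hz : z ∈ Siegel (n - 1)) (hu : u ∈ Siegel (n - 1))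
    (hv : v ∈ Siegel (n - 1)) (huv : sbeta u v ≤ r) :
    (1 - Real.tanh r) / (1 + Real.tanh r) ≤
        ‖srho2 z u‖ / ‖srho2 z v‖ ∧
      ‖srho2 z u‖ / ‖srho2 z v‖ ≤
        (1 + Real.tanh r) / (1 - Real.tanh r) := by
  have htanh : 0 ≤ Real.tanh r := by
    rw [Real.tanh_eq_sinh_div_cosh]
    exact div_nonneg (Real.sinh_nonneg_iff.2 hr.le) (Real.cosh_pos r).le
  exact srho2_quotient_bounds hz hu hv htanh (Real.tanh_lt_one r)
    (norm_srho2_sq_sub_le_of_sbeta_le hu hv huv)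
end

section
/- Given λ ∈ ℝ and j ∈ ℕ, there is a constant C = C(n, λ, j) > 0 such that for all z ∈ 𝒰 and all w ∈ 𝒰 with β(w, 𝐢) ≤ j one has ρ(w)^λ / |ρ(z,w)|^{n+1+λ} ≤ C / |ρ(z, 𝐢)|^{n+1+λ}. -/
open MeasureTheory Filter

/-- Comparable positive reals have comparable real powers. -/
lemma rpow_le_of_comparable {x y L : ℝ} (hx : 0 < x) (hy : 0 < y) (hL : 0 < L)
    (hxy : x ≤ L * y) (hyx : y ≤ L * x) (s : ℝ) : x ^ s ≤ L ^ |s| * y ^ s := by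
  rcases le_total 0 s with hs | hs
  · rw [abs_of_nonneg hs, ← Real.mul_rpow hL.le hy.le]
    exact Real.rpow_le_rpow hx.le hxy hs
  · have h : (L * x) ^ s ≤ y ^ s := Real.rpow_le_rpow_of_nonpos hy hyx hs
    rw [Real.mul_rpow hL.le hx.le] at h
    rw [abs_of_nonpos hs, Real.rpow_neg hL.le, inv_mul_eq_div, le_div_iff₀' (by positivity)]
    exact h

lemma exp_neg_le_or_one_le_of_artanh_sqrt_le {q r : ℝ} (hq : 0 < q)
    (h : artanh (Real.sqrt (1 - q)) ≤ r) : Real.exp (-(2 * r)) ≤ q ∨ 1 ≤ q := by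
  refine or_iff_not_imp_right.2 fun h1 => ?_
  rw [not_le] at h1
  have ht0 := Real.sqrt_nonneg (1 - q)
  have ht2 : Real.sqrt (1 - q) ^ 2 = 1 - q := Real.sq_sqrt (by linarith)
  set t := Real.sqrt (1 - q)
  have ht1 : t < 1 := by nlinarith
  unfold artanh at h
  have h2 : (1 + t) / (1 - t) ≤ Real.exp (2 * r) := by
    rw [← Real.log_le_iff_le_exp (by apply div_pos <;> linarith)]
    linarith
  rw [div_le_iff₀ (by linarith)] at h2
  rw [Real.exp_neg, inv_le_iff_one_le_mul₀' (Real.exp_pos _)]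
  have := Real.exp_pos (2 * r)
  nlinarith [mul_nonneg this.le (mul_nonneg ht0 (sub_nonneg.2 ht1.le))]

lemma norm_srho2_base {m : ℕ} (z : SPoint m) :
    ‖srho2 z ((0 : Fin m → ℂ), Complex.I)‖ = ‖z.2 + Complex.I‖ / 2 := by
  have : srho2 z ((0 : Fin m → ℂ), Complex.I) = -(Complex.I / 2) * (z.2 + Complex.I) := by
    simp [srho2]; ring
  rw [this]; simp; ring

lemma sum_norm_sq_nonneg {m : ℕ} (z : SPoint m) : 0 ≤ ∑ k, ‖z.1 k‖ ^ 2 :=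
  Finset.sum_nonneg fun _ _ => by positivity

lemma sum_norm_sq_lt_im {m : ℕ} {z : SPoint m} (hz : z ∈ Siegel m) : ∑ k, ‖z.1 k‖ ^ 2 < z.2.im :=
  sub_pos.1 hz

lemma im_add_one_le_norm (a : ℂ) : a.im + 1 ≤ ‖a + Complex.I‖ := by
  simpa using (le_abs_self _).trans (Complex.abs_im_le_norm (a + Complex.I))

lemma norm_le_norm_add_I {a : ℂ} (ha : 0 ≤ a.im) : ‖a‖ ≤ ‖a + Complex.I‖ := by
  rw [← sq_le_sq₀ (norm_nonneg _) (norm_nonneg _), ← Complex.normSq_eq_norm_sq,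
    ← Complex.normSq_eq_norm_sq, Complex.normSq_apply, Complex.normSq_apply]
  simp; nlinarith

lemma norm_sum_mul_conj_le {m : ℕ} (z w : SPoint m) :
    ‖∑ k, z.1 k * (starRingEnd ℂ) (w.1 k)‖ ≤
      (∑ k, ‖z.1 k‖ ^ 2 + ∑ k, ‖w.1 k‖ ^ 2) / 2 := by
  rw [← Finset.sum_add_distrib, Finset.sum_div]
  refine norm_sum_le_of_le _ fun k _ => ?_
  rw [norm_mul, RCLike.norm_conj]
  nlinarith [sq_nonneg (‖z.1 k‖ - ‖w.1 k‖)]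

lemma re_srho2 {m : ℕ} (z w : SPoint m) :
    (srho2 z w).re = (srho z + srho w + ∑ k, ‖z.1 k - w.1 k‖ ^ 2) / 2 := by
  have h : ∑ k, ‖z.1 k - w.1 k‖ ^ 2 = ∑ k, ‖z.1 k‖ ^ 2 + ∑ k, ‖w.1 k‖ ^ 2
      - 2 * ∑ k, (z.1 k * (starRingEnd ℂ) (w.1 k)).re := by
    rw [Finset.mul_sum, ← Finset.sum_add_distrib, ← Finset.sum_sub_distrib]
    refine Finset.sum_congr rfl fun k _ => ?_
    simp only [← Complex.normSq_eq_norm_sq]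
    exact Complex.normSq_sub _ _
  rw [h]
  simp only [srho2, srho, Complex.sub_re, Complex.re_sum]
  simp [Complex.mul_re]
  ring

lemma sum_norm_sq_le {m : ℕ} (z w : SPoint m) :
    ∑ k, ‖z.1 k‖ ^ 2 ≤ 2 * ∑ k, ‖z.1 k - w.1 k‖ ^ 2 + 2 * ∑ k, ‖w.1 k‖ ^ 2 := by
  rw [Finset.mul_sum, Finset.mul_sum, ← Finset.sum_add_distrib]
  refine Finset.sum_le_sum fun k _ => ?_
  have h : ‖z.1 k‖ ≤ ‖z.1 k - w.1 k‖ + ‖w.1 k‖ := by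
    simpa using norm_add_le (z.1 k - w.1 k) (w.1 k)
  nlinarith [sq_nonneg (‖z.1 k - w.1 k‖ - ‖w.1 k‖), norm_nonneg (z.1 k)]

/-- Bergman balls about `𝐢` are bounded and stay away from the boundary. -/
lemma bounds_of_sbeta_le {m : ℕ} {w : SPoint m} (hw : w ∈ Siegel m) {r : ℝ} (hr : 0 ≤ r)
    (h : sbeta w ((0 : Fin m → ℂ), Complex.I) ≤ r) :
    1 ≤ 4 * Real.exp (2 * r) * srho w ∧ ‖w.2 + Complex.I‖ ≤ 4 * Real.exp (2 * r) := by
  have hw' : 0 < srho w := hw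
  have hW := sum_norm_sq_nonneg w
  have him := sum_norm_sq_lt_im hw
  have hle : srho w ≤ w.2.im := sub_le_self _ hW
  have hB := im_add_one_le_norm w.2
  have hbase : srho ((0 : Fin m → ℂ), Complex.I) = 1 := by simp [srho]
  unfold sbeta at h
  rw [norm_srho2_base, hbase, mul_one] at h
  set B := ‖w.2 + Complex.I‖
  have hB0 : 0 < (B / 2) ^ 2 := by
    have : 0 < B := by linarith
    positivity
  have hE : Real.exp (-(2 * r)) ≤ srho w / (B / 2) ^ 2 := by
    rcases exp_neg_le_or_one_le_of_artanh_sqrt_le (div_pos hw' hB0) h with h | h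
    · exact h
    · exact (Real.exp_le_one_iff.2 (by linarith)).trans h
  rw [Real.exp_neg, le_div_iff₀ hB0, inv_mul_le_iff₀ (Real.exp_pos _)] at hE
  have he := Real.exp_pos (2 * r)
  constructor
  · nlinarith
  · have : Real.exp (2 * r) * srho w ≤ Real.exp (2 * r) * B := by gcongr; linarith
    nlinarith

lemma norm_srho2_le {m : ℕ} {z w : SPoint m} (hz : z ∈ Siegel m) (hw : w ∈ Siegel m) :
    ‖srho2 z w‖ ≤ ‖w.2 + Complex.I‖ + ‖z.2 + Complex.I‖ := by
  have h1 : ‖srho2 z w‖ ≤ (‖w.2‖ + ‖z.2‖) / 2 + (∑ k, ‖z.1 k‖ ^ 2 + ∑ k, ‖w.1 k‖ ^ 2) / 2 := by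
    refine (norm_sub_le _ _).trans (add_le_add ?_ (norm_sum_mul_conj_le z w))
    have := norm_sub_le ((starRingEnd ℂ) w.2) z.2
    rw [RCLike.norm_conj] at this
    rw [norm_mul, norm_div, Complex.norm_I, Complex.norm_ofNat]
    linarith
  have hz1 := sum_norm_sq_lt_im hz
  have hw1 := sum_norm_sq_lt_im hw
  have := norm_le_norm_add_I ((sum_norm_sq_nonneg z).trans hz1.le)
  have := norm_le_norm_add_I ((sum_norm_sq_nonneg w).trans hw1.le)
  linarith [im_add_one_le_norm z.2, im_add_one_le_norm w.2]

lemma norm_add_I_le {m : ℕ} {z w : SPoint m} (hz : z ∈ Siegel m) (hw : w ∈ Siegel m) :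
    ‖z.2 + Complex.I‖ ≤ 6 * ‖srho2 z w‖ + 4 * ‖w.2 + Complex.I‖ := by
  have hz0 : 0 < srho z := hz
  have hw0 : 0 < srho w := hw
  have hw1 := sum_norm_sq_lt_im hw
  have hwn := norm_le_norm_add_I ((sum_norm_sq_nonneg w).trans hw1.le)
  have hwi := im_add_one_le_norm w.2
  have hre := Complex.re_le_norm (srho2 z w)
  rw [re_srho2] at hre
  have hZ := sum_norm_sq_le z w
  have hs := norm_sum_mul_conj_le z w
  have hz2 : z.2 = (starRingEnd ℂ) w.2 +
      2 * Complex.I * (srho2 z w + ∑ k, z.1 k * (starRingEnd ℂ) (w.1 k)) := by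
    simp only [srho2]
    linear_combination (z.2 - (starRingEnd ℂ) w.2) * Complex.I_sq
  have h1 : ‖z.2‖ ≤ ‖w.2‖ + 2 * (‖srho2 z w‖ + ‖∑ k, z.1 k * (starRingEnd ℂ) (w.1 k)‖) := by
    conv_lhs => rw [hz2]
    refine (norm_add_le _ _).trans ?_
    rw [RCLike.norm_conj, norm_mul, norm_mul, Complex.norm_I, Complex.norm_ofNat, mul_one]
    gcongr
    exact norm_add_le _ _
  have h2 : ‖z.2 + Complex.I‖ ≤ ‖z.2‖ + 1 := by simpa using norm_add_le z.2 Complex.I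
  linarith


/-- given `λ ∈ ℝ` and `j ∈ ℕ`, there is `C = C(n,λ,j) > 0` with
`ρ(w)^λ / |ρ(z,w)|^{n+1+λ} ≤ C / |ρ(z,𝐢)|^{n+1+λ}` whenever `β(w,𝐢) ≤ j`. -/
theorem sup_over_Qj_estimate (n : ℕ) (hn : 1 ≤ n) (lam : ℝ) (j : ℕ) (hj : 1 ≤ j) :
    ∃ C : ℝ, 0 < C ∧ ∀ z ∈ Siegel (n - 1), ∀ w ∈ Siegel (n - 1),
      sbeta w ((0 : Fin (n - 1) → ℂ), Complex.I) ≤ (j : ℝ) →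
      srho w ^ lam / ‖srho2 z w‖ ^ ((n : ℝ) + 1 + lam) ≤
        C / ‖srho2 z ((0 : Fin (n - 1) → ℂ), Complex.I)‖ ^ ((n : ℝ) + 1 + lam) := by
  set K := 4 * Real.exp (2 * (j : ℝ)) with hK
  have hK1 : 1 ≤ K := by
    have := Real.one_le_exp (x := 2 * (j : ℝ)) (by positivity)
    linarith
  have hK0 : 0 < K := by linarith
  have hL0 : 0 < 8 * K ^ 2 := by positivity
  set s := (n : ℝ) + 1 + lam
  refine ⟨K ^ |lam| * (8 * K ^ 2) ^ |s|, by positivity, fun z hz w hw hβ => ?_⟩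
  obtain ⟨hρ, hwK⟩ := bounds_of_sbeta_le hw (Nat.cast_nonneg j) hβ
  rw [← hK] at hρ hwK
  have hz0 : 0 < srho z := hz
  have hw0 : 0 < srho w := hw
  have hρK : srho w ≤ K := by
    have : srho w ≤ w.2.im := sub_le_self _ (sum_norm_sq_nonneg w)
    linarith [im_add_one_le_norm w.2]
  have hA : srho w ≤ 2 * ‖srho2 z w‖ := by
    have hre := Complex.re_le_norm (srho2 z w)
    rw [re_srho2] at hre
    have : 0 ≤ ∑ k, ‖z.1 k - w.1 k‖ ^ 2 := Finset.sum_nonneg fun _ _ => by positivity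
    linarith
  have hKA : 1 ≤ 2 * K * ‖srho2 z w‖ := by nlinarith
  have hB1 : 1 ≤ ‖z.2 + Complex.I‖ := by
    linarith [im_add_one_le_norm z.2, sum_norm_sq_lt_im hz, sum_norm_sq_nonneg z]
  have hup := norm_srho2_le hz hw
  have hlow := norm_add_I_le hz hw
  rw [norm_srho2_base]
  set A := ‖srho2 z w‖
  set B := ‖z.2 + Complex.I‖
  have hA0 : 0 < A := by linarith
  have hKK : 1 ≤ K ^ 2 := one_le_pow₀ hK1
  have hBA : B / 2 ≤ 8 * K ^ 2 * A := by nlinarith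
  have hAB : A ≤ 8 * K ^ 2 * (B / 2) := by
    have : K ≤ K ^ 2 := by nlinarith
    nlinarith
  have hBs := rpow_le_of_comparable (by linarith) hA0 hL0 hBA hAB s
  have hρs := rpow_le_of_comparable hw0 one_pos hK0 (by linarith) hρ lam
  rw [Real.one_rpow, mul_one] at hρs
  rw [div_le_div_iff₀ (by positivity) (by positivity), mul_assoc]
  exact mul_le_mul hρs hBs (by positivity) (by positivity)
end
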